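/- Let σ = (σ_k)_{k≥0} be a left proper or right proper sequence of substitutions σ_k: A_{k+1}* → A_k* such that the incidence matrix M_{σ_k} is invertible for all k ≥ 0. If L_σ is letter-balanced, then L_σ is factor-balanced. -/

import Mathlib

open List

/-- Number of occurrences of `v` as a factor of `w`, i.e. the number of
decompositions `w = p ++ v ++ s`. -/
def occ {A : Type*} [DecidableEq A] (v w : List A) : ℕ :=
  (List.range (w.length + 1)).countP (fun i => decide (v <+: w.drop i))

/-- Apply a substitution (given by its values on letters) to a word. -/
def applyS {A B : Type*} (σ : A → List B) (w : List A) : List B :=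
  (w.map σ).flatten

/-- A substitution is left proper if all images of letters start with the same
letter (in particular they are nonempty). -/
def LeftProper {A B : Type*} (σ : A → List B) : Prop :=
  ∃ b : B, ∀ a : A, ∃ t : List B, σ a = b :: t

/-- A substitution is right proper if all images of letters end with the same
letter (in particular they are nonempty). -/
def RightProper {A B : Type*} (σ : A → List B) : Prop :=
  ∃ b : B, ∀ a : A, ∃ t : List B, σ a = t ++ [b]

/-- For a sequence of substitutions `σₖ : A_{k+1}* → A_k*`, the composition
`σ_{[k,k+m)} = σ_k ∘ σ_{k+1} ∘ ⋯ ∘ σ_{k+m-1} : A_{k+m}* → A_k*`, on letters. -/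
def seg {A : ℕ → Type*} (σ : ∀ k, A (k + 1) → List (A k)) (k : ℕ) :
    (m : ℕ) → A (k + m) → List (A k)
  | 0, a => [a]
  | m + 1, a => applyS (seg σ k m) (σ (k + m) a)

/-- The language of the sequence `σ` at level `k`: words over `A_k` that are factors
of `σ_{[k,n)}(a)` for some letter `a ∈ A_n`, for infinitely many `n > k`
(written with `n = k + m`, `m > 0`). -/
def LangAt {A : ℕ → Type*}
    (σ : ∀ k, A (k + 1) → List (A k)) (k : ℕ) : Set (List (A k)) :=
  {w | {m : ℕ | 0 < m ∧ ∃ a : A (k + m), w <:+: seg σ k m a}.Infinite}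

lemma occ_nil {A : Type*} [DecidableEq A] (v : List A) :
    occ v [] = if v = [] then 1 else 0 := by
  simp [occ, List.countP_cons]

lemma occ_cons {A : Type*} [DecidableEq A] (v w : List A) (a : A) :
    occ v (a :: w) = (if v <+: a :: w then 1 else 0) + occ v w := by
  unfold occ
  rw [List.length_cons, List.range_succ_eq_map, List.countP_cons, List.countP_map, add_comm]
  simp [Function.comp_def]

lemma occ_concat {A : Type*} [DecidableEq A] (v w : List A) (a : A) :
    occ v (w ++ [a]) = occ v w + (if v <:+ w ++ [a] then 1 else 0) := by
  induction w with
  | nil =>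
    rw [List.nil_append, occ_cons, occ_nil, add_comm]
    congr 1
    have : v <+: [a] ↔ v <:+ [a] := by
      rw [show [a] = [] ++ [a] from rfl, List.prefix_concat_iff, List.nil_append,
        List.suffix_cons_iff, List.prefix_nil, List.suffix_nil]
    simp only [this]
  | cons b w ih =>
    rw [List.cons_append, occ_cons, ih, occ_cons]
    have h1 : v <+: b :: (w ++ [a]) ↔ v = b :: (w ++ [a]) ∨ v <+: b :: w := by
      rw [← List.cons_append, List.prefix_concat_iff, List.cons_append]
    have h2 : v <:+ b :: (w ++ [a]) ↔ v = b :: (w ++ [a]) ∨ v <:+ w ++ [a] :=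
      List.suffix_cons_iff
    by_cases h : v = b :: (w ++ [a])
    · subst h
      have h3 : ¬ b :: (w ++ [a]) <+: b :: w := fun h' => by
        have := h'.length_le
        simp at this
      have h4 : ¬ b :: (w ++ [a]) <:+ w ++ [a] := fun h' => by
        have := h'.length_le
        simp at this
      rw [if_pos (h1.2 (Or.inl rfl)), if_pos (h2.2 (Or.inl rfl)), if_neg h3, if_neg h4]
      omega
    · simp only [h1, h2, h, false_or]
      omega

lemma occ_reverse {A : Type*} [DecidableEq A] (v w : List A) :
    occ v.reverse w.reverse = occ v w := by
  induction w with
  | nil => simp [occ_nil]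
  | cons a w ih =>
    have h : v.reverse <:+ w.reverse ++ [a] ↔ v <+: a :: w := by
      rw [← List.reverse_cons, List.reverse_suffix]
    rw [List.reverse_cons, occ_concat, occ_cons, ih, add_comm]
    simp only [h]

lemma occ_singleton {A : Type*} [DecidableEq A] (a : A) (w : List A) :
    occ [a] w = w.count a := by
  induction w with
  | nil => simp [occ_nil]
  | cons b w ih =>
    rw [occ_cons, ih, List.count_cons, add_comm]
    simp [eq_comm (a := a)]

lemma occ_le_occ_append_left {A : Type*} [DecidableEq A] (v s x : List A) :
    occ v x ≤ occ v (s ++ x) ∧ occ v (s ++ x) ≤ occ v x + s.length := by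
  induction s with
  | nil => simp
  | cons a s ih =>
    rw [List.cons_append, occ_cons, List.length_cons]
    split_ifs <;> omega

lemma occ_le_occ_append_right {A : Type*} [DecidableEq A] (v x p : List A) :
    occ v x ≤ occ v (x ++ p) ∧ occ v (x ++ p) ≤ occ v x + p.length := by
  have := occ_le_occ_append_left v.reverse p.reverse x.reverse
  rwa [← List.reverse_append, occ_reverse, occ_reverse, List.length_reverse] at this

/-- The occurrences of `v` starting in `x` only depend on `x` and the next `|v| - 1` letters. -/
lemma occ_append_append {A : Type*} [DecidableEq A] (v x P s : List A)
    (hP : v.length ≤ P.length + 1) :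
    occ v (x ++ (P ++ s)) + occ v P = occ v (x ++ P) + occ v (P ++ s) := by
  induction x with
  | nil => simp [add_comm]
  | cons a x ih =>
    have h : v <+: a :: (x ++ (P ++ s)) ↔ v <+: a :: (x ++ P) := by
      constructor
      · intro h
        refine List.prefix_of_prefix_length_le h ⟨s, by simp⟩ ?_
        simp only [List.length_cons, List.length_append]
        omega
      · intro h
        exact h.trans ⟨s, by simp⟩
    rw [List.cons_append, List.cons_append, occ_cons, occ_cons]
    simp only [h]
    omega

lemma applyS_nil {A B : Type*} (τ : A → List B) : applyS τ [] = [] := rfl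

lemma applyS_cons {A B : Type*} (τ : A → List B) (a : A) (u : List A) :
    applyS τ (a :: u) = τ a ++ applyS τ u := by
  simp [applyS]

lemma applyS_append {A B : Type*} (τ : A → List B) (u u' : List A) :
    applyS τ (u ++ u') = applyS τ u ++ applyS τ u' := by
  simp [applyS]

lemma applyS_singleton {A : Type*} (u : List A) : applyS (fun a => [a]) u = u := by
  induction u with
  | nil => rfl
  | cons a u ih => rw [applyS_cons, ih, List.singleton_append]

lemma applyS_applyS {A B C : Type*} (τ : B → List C) (ρ : A → List B) (u : List A) :
    applyS (fun a => applyS τ (ρ a)) u = applyS τ (applyS ρ u) := by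
  induction u with
  | nil => rfl
  | cons a u ih => rw [applyS_cons, applyS_cons, applyS_append, ih]

lemma applyS_reverse {A B : Type*} (τ : A → List B) (u : List A) :
    applyS (fun a => (τ a).reverse) u.reverse = (applyS τ u).reverse := by
  induction u with
  | nil => rfl
  | cons a u ih =>
    rw [applyS_cons, List.reverse_cons, applyS_append, ih, List.reverse_append, applyS_cons,
      applyS_nil, List.append_nil]

lemma eq_applyS_append_of_prefix_applyS {A B : Type*} (τ : A → List B) (K : ℕ)
    (hK : ∀ a, (τ a).length ≤ K) (U : List A) (w : List B) (hw : w <+: applyS τ U) :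
    ∃ u p, w = applyS τ u ++ p ∧ p.length ≤ K := by
  induction U generalizing w with
  | nil => exact ⟨[], [], by simpa [applyS_nil] using hw, by simp⟩
  | cons a U ih =>
    obtain ⟨r, hr⟩ := hw
    rw [applyS_cons, List.append_eq_append_iff] at hr
    rcases hr with ⟨c, h1, -⟩ | ⟨c, h1, h2⟩
    · refine ⟨[], w, by simp [applyS_nil], le_trans ?_ (hK a)⟩
      simp [h1]
    · obtain ⟨u, p, hu, hp⟩ := ih c ⟨r, h2.symm⟩
      exact ⟨a :: u, p, by rw [h1, hu, applyS_cons, List.append_assoc], hp⟩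

lemma eq_append_applyS_append_of_infix_applyS {A B : Type*} (τ : A → List B) (K : ℕ)
    (hK : ∀ a, (τ a).length ≤ K) (U : List A) (w : List B) (hw : w <:+: applyS τ U) :
    ∃ s u p, w = s ++ (applyS τ u ++ p) ∧ s.length ≤ K ∧ p.length ≤ K := by
  induction U with
  | nil => exact ⟨[], [], [], by simpa [applyS_nil] using hw, by simp, by simp⟩
  | cons a U ih =>
    obtain ⟨t, r, hr⟩ := hw
    rw [applyS_cons, List.append_assoc, List.append_eq_append_iff] at hr
    rcases hr with ⟨c, h1, h2⟩ | ⟨c, h1, h2⟩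
    · have hc : c.length ≤ K := le_trans (by simp [h1]) (hK a)
      rw [List.append_eq_append_iff] at h2
      rcases h2 with ⟨d, h3, -⟩ | ⟨d, h3, h4⟩
      · exact ⟨w, [], [], by simp [applyS_nil], le_trans (by simp [h3]) hc, by simp⟩
      · obtain ⟨u, p, hu, hp⟩ :=
          eq_applyS_append_of_prefix_applyS τ K hK U d ⟨r, h4.symm⟩
        exact ⟨c, u, p, by rw [h3, hu], hc, hp⟩
    · exact ih ⟨c, r, by rw [h2, List.append_assoc]⟩

/-- If `P` is a prefix of every `τ(u)P` and `|v| ≤ |P| + 1`, the occurrences of `v` in `τ(u)P`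
are counted additively over the letters of `u`. -/
lemma occ_applyS_append {A B : Type*} [DecidableEq B] (τ : A → List B) (P v : List B)
    (hP : ∀ u, P <+: applyS τ u ++ P) (hv : v.length ≤ P.length + 1) (u : List A) :
    (occ v (applyS τ u ++ P) : ℤ) =
      occ v P + (u.map fun a => (occ v (τ a ++ P) : ℤ) - occ v P).sum := by
  induction u with
  | nil => simp [applyS_nil]
  | cons a u ih =>
    obtain ⟨s, hs⟩ := hP u
    have h := occ_append_append v (τ a) P s hv
    rw [hs] at h
    rw [applyS_cons, List.append_assoc, List.map_cons, List.sum_cons]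
    linarith [(by exact_mod_cast h :
      (occ v (τ a ++ (applyS τ u ++ P)) : ℤ) + occ v P =
        occ v (τ a ++ P) + occ v (applyS τ u ++ P))]

lemma sum_map_eq_sum_count_mul {A : Type*} [Fintype A] [DecidableEq A] (f : A → ℤ) (u : List A) :
    (((u.map f).sum : ℤ) : ℚ) = ∑ a, (f a : ℚ) * u.count a := by
  induction u with
  | nil => simp
  | cons b u ih =>
    rw [List.map_cons, List.sum_cons, Int.cast_add, ih]
    simp [List.count_cons, mul_add, Finset.sum_add_distrib, add_comm]

/-- The composition `σ_0 ∘ ⋯ ∘ σ_{l-1}`, on letters of `A l`. -/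
def toBase {A : ℕ → Type*} (σ : ∀ k, A (k + 1) → List (A k)) : (l : ℕ) → A l → List (A 0)
  | 0, a => [a]
  | l + 1, a => applyS (toBase σ l) (σ l a)

lemma toBase_add {A : ℕ → Type*} (σ : ∀ k, A (k + 1) → List (A k)) (l m : ℕ) (a : A (l + m)) :
    toBase σ (l + m) a = applyS (toBase σ l) (seg σ l m a) := by
  induction m with
  | zero => simp [seg, applyS]
  | succ m ih =>
    change applyS (toBase σ (l + m)) (σ (l + m) a) =
      applyS (toBase σ l) (applyS (seg σ l m) (σ (l + m) a))
    rw [← applyS_applyS, funext ih]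

lemma toBase_zero_add {A : ℕ → Type*} (σ : ∀ k, A (k + 1) → List (A k)) (m : ℕ)
    (a : A (0 + m)) : toBase σ (0 + m) a = seg σ 0 m a := by
  rw [toBase_add]
  exact applyS_singleton _

lemma exists_applyS_toBase_eq {A : ℕ → Type*} (σ : ∀ k, A (k + 1) → List (A k)) {l n : ℕ}
    (h : l ≤ n) (u : List (A n)) : ∃ U, applyS (toBase σ n) u = applyS (toBase σ l) U := by
  induction n, h using Nat.le_induction with
  | base => exact ⟨u, rfl⟩
  | succ n _ ih =>
    obtain ⟨U, hU⟩ := ih (applyS (σ n) u)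
    exact ⟨U, (applyS_applyS (toBase σ n) (σ n) u).trans hU⟩

lemma exists_infix_applyS_toBase {A : ℕ → Type*} (σ : ∀ k, A (k + 1) → List (A k)) (l : ℕ)
    {w : List (A 0)} (hw : w ∈ LangAt σ 0) : ∃ U, w <:+: applyS (toBase σ l) U := by
  obtain ⟨m, ⟨-, a, ha⟩, hm⟩ := Set.Infinite.exists_gt hw l
  obtain ⟨U, hU⟩ := exists_applyS_toBase_eq σ (show l ≤ 0 + m by omega) [a]
  refine ⟨U, ?_⟩
  rwa [← hU, applyS_cons, applyS_nil, List.append_nil, toBase_zero_add]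

lemma count_applyS {A B : Type*} [Fintype A] [DecidableEq A] [DecidableEq B] (τ : A → List B)
    (u : List A) (b : B) :
    ((applyS τ u).count b : ℚ) = ∑ a, ((τ a).count b : ℚ) * u.count a := by
  induction u with
  | nil => simp [applyS_nil]
  | cons c u ih =>
    rw [applyS_cons, List.count_append, Nat.cast_add, ih]
    simp [List.count_cons, mul_add, Finset.sum_add_distrib, add_comm]

lemma exists_count_eq_sum_count_toBase {A : ℕ → Type*}
    [∀ k, Fintype (A k)] [∀ k, DecidableEq (A k)] (σ : ∀ k, A (k + 1) → List (A k))
    (hM : ∀ k : ℕ, ∃ N : Matrix (A (k + 1)) (A k) ℚ,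
      N * (Matrix.of fun (b : A k) (a : A (k + 1)) => ((σ k a).count b : ℚ)) = 1) (l : ℕ) :
    ∃ N : A l → A 0 → ℚ, ∀ u a,
      (u.count a : ℚ) = ∑ b, N a b * (applyS (toBase σ l) u).count b := by
  induction l with
  | zero =>
    refine ⟨fun a b => if a = b then 1 else 0, fun u a => ?_⟩
    rw [show applyS (toBase σ 0) u = u from applyS_singleton u]
    simp
  | succ l ih =>
    obtain ⟨N, hN⟩ := ih
    obtain ⟨R, hR⟩ := hM l
    refine ⟨fun a b => ∑ c, R a c * N c b, fun u a => ?_⟩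
    have hσ : (u.count a : ℚ) = ∑ c, R a c * (applyS (σ l) u).count c := by
      have h := congrFun (congrArg (fun X => Matrix.mulVec X fun a' => (u.count a' : ℚ)) hR) a
      simp only [← Matrix.mulVec_mulVec, Matrix.one_mulVec] at h
      rw [← h]
      simp only [count_applyS]
      rfl
    have hc : applyS (toBase σ (l + 1)) u = applyS (toBase σ l) (applyS (σ l) u) :=
      applyS_applyS (toBase σ l) (σ l) u
    rw [hσ, hc]
    simp only [hN (applyS (σ l) u), Finset.mul_sum, Finset.sum_mul]
    rw [Finset.sum_comm]
    simp only [mul_assoc]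

lemma exists_prefix_length_ge {A : ℕ → Type*} (σ : ∀ k, A (k + 1) → List (A k))
    (hproper : ∀ k : ℕ, ∃ m : ℕ, 0 < m ∧ LeftProper (seg σ k m)) (n : ℕ) :
    ∃ l, (∀ a, toBase σ l a ≠ []) ∧
      ∃ P : List (A 0), n ≤ P.length ∧ ∀ u, P <+: applyS (toBase σ l) u ++ P := by
  induction n with
  | zero => exact ⟨0, fun a => by simp [toBase], [], by simp, by simp⟩
  | succ n ih =>
    obtain ⟨l, hne, P, hP, hpre⟩ := ih
    obtain ⟨m, -, b, hb⟩ := hproper l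
    refine ⟨l + m, fun a => ?_, toBase σ l b ++ P, ?_, fun u => ?_⟩
    · obtain ⟨t, ht⟩ := hb a
      rw [toBase_add, ht, applyS_cons]
      simp [hne b]
    · have := List.length_pos_iff.2 (hne b)
      rw [List.length_append]
      omega
    · rw [funext (toBase_add σ l m), applyS_applyS]
      cases u with
      | nil => simp [applyS_nil]
      | cons a u =>
        obtain ⟨t, ht⟩ := hb a
        rw [applyS_cons, ht, List.cons_append, applyS_cons, List.append_assoc,
          List.prefix_append_right_inj]
        have h := hpre (t ++ applyS (seg σ l m) u ++ [b])
        rwa [applyS_append, applyS_cons, applyS_nil, List.append_nil, List.append_assoc] at h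

lemma exists_occ_near_linear_of_leftProper {A : ℕ → Type*}
    [∀ k, Fintype (A k)] [∀ k, DecidableEq (A k)] (σ : ∀ k, A (k + 1) → List (A k))
    (hproper : ∀ k : ℕ, ∃ m : ℕ, 0 < m ∧ LeftProper (seg σ k m))
    (hM : ∀ k : ℕ, ∃ N : Matrix (A (k + 1)) (A k) ℚ,
      N * (Matrix.of fun (b : A k) (a : A (k + 1)) => ((σ k a).count b : ℚ)) = 1)
    (v : List (A 0)) :
    ∃ (c : A 0 → ℚ) (K : ℚ), ∀ w ∈ LangAt σ 0,
      |(occ v w : ℚ) - ∑ b, c b * w.count b| ≤ K := by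
  obtain ⟨l, -, P, hvP, hP⟩ := exists_prefix_length_ge σ hproper v.length
  obtain ⟨N, hN⟩ := exists_count_eq_sum_count_toBase σ hM l
  obtain ⟨K, hK⟩ : ∃ K, ∀ a, (toBase σ l a).length ≤ K :=
    ⟨_, fun a => Finset.le_sup (f := fun a => (toBase σ l a).length) (Finset.mem_univ a)⟩
  set f : A l → ℤ := fun a => (occ v (toBase σ l a ++ P) : ℤ) - occ v P with hf
  set c : A 0 → ℚ := fun b => ∑ a, (f a : ℚ) * N a b with hc
  refine ⟨c, 2 * K + P.length + occ v P + ∑ b, |c b| * (2 * K), fun w hw => ?_⟩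
  obtain ⟨U, hU⟩ := exists_infix_applyS_toBase σ l hw
  obtain ⟨s, u, p, rfl, hs, hp⟩ := eq_append_applyS_append_of_infix_applyS _ K hK U w hU
  set x := applyS (toBase σ l) u with hx
  have h1 := occ_applyS_append _ P v hP (by omega) u
  have h2 : (((u.map f).sum : ℤ) : ℚ) = ∑ b, c b * x.count b := by
    rw [sum_map_eq_sum_count_mul]
    simp only [hN u, Finset.mul_sum, hc, Finset.sum_mul]
    rw [Finset.sum_comm]
    simp only [mul_assoc, hx]
  have h3 : (occ v (x ++ P) : ℚ) = occ v P + ∑ b, c b * x.count b := by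
    rw [← h2]
    exact (by simpa only [Int.cast_add, Int.cast_natCast] using congrArg (Int.cast (R := ℚ)) h1)
  have hxP := occ_le_occ_append_right v x P
  have hxp := occ_le_occ_append_right v x p
  have hsx := occ_le_occ_append_left v s (x ++ p)
  have h4 : |(occ v (s ++ (x ++ p)) : ℚ) - occ v (x ++ P)| ≤ 2 * K + P.length := by
    rw [abs_le]
    constructor
    · have : occ v (x ++ P) ≤ occ v (s ++ (x ++ p)) + (2 * K + P.length) := by omega
      have : (occ v (x ++ P) : ℚ) ≤ occ v (s ++ (x ++ p)) + (2 * K + P.length) := by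
        exact_mod_cast this
      linarith
    · have : occ v (s ++ (x ++ p)) ≤ occ v (x ++ P) + (2 * K + P.length) := by omega
      have : (occ v (s ++ (x ++ p)) : ℚ) ≤ occ v (x ++ P) + (2 * K + P.length) := by
        exact_mod_cast this
      linarith
  have h5 : |∑ b, c b * x.count b - ∑ b, c b * (s ++ (x ++ p)).count b| ≤
      ∑ b, |c b| * (2 * K) := by
    rw [← Finset.sum_sub_distrib]
    refine (Finset.abs_sum_le_sum_abs _ _).trans (Finset.sum_le_sum fun b _ => ?_)
    rw [← mul_sub, abs_mul]
    refine mul_le_mul_of_nonneg_left ?_ (abs_nonneg _)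
    have hsb := (List.count_le_length (a := b) (l := s)).trans hs
    have hpb := (List.count_le_length (a := b) (l := p)).trans hp
    have hle : (s.count b : ℚ) + p.count b ≤ 2 * K := by
      have : s.count b + p.count b ≤ 2 * K := by omega
      exact_mod_cast this
    simp only [List.count_append, Nat.cast_add]
    rw [abs_sub_comm, abs_of_nonneg] <;>
      linarith [Nat.cast_nonneg (α := ℚ) (s.count b), Nat.cast_nonneg (α := ℚ) (p.count b)]
  have h6 : (0 : ℚ) ≤ occ v P := Nat.cast_nonneg _
  rw [abs_le] at h4 h5 ⊢
  constructor <;> linarith [h4.1, h4.2, h5.1, h5.2]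

lemma seg_reverse {A : ℕ → Type*} (σ : ∀ k, A (k + 1) → List (A k)) (k m : ℕ) (a : A (k + m)) :
    seg (fun k a => (σ k a).reverse) k m a = (seg σ k m a).reverse := by
  induction m with
  | zero => rfl
  | succ m ih =>
    change applyS (seg (fun k a => (σ k a).reverse) k m) (σ (k + m) a).reverse =
      (applyS (seg σ k m) (σ (k + m) a)).reverse
    rw [funext ih, applyS_reverse]

lemma reverse_mem_LangAt {A : ℕ → Type*} (σ : ∀ k, A (k + 1) → List (A k)) (k : ℕ)
    {w : List (A k)} (hw : w ∈ LangAt σ k) :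
    w.reverse ∈ LangAt (fun k a => (σ k a).reverse) k := by
  refine Set.Infinite.mono ?_ hw
  rintro m ⟨hm, a, ha⟩
  exact ⟨hm, a, by simpa [seg_reverse] using ha⟩

lemma RightProper.reverse {A B : Type*} {τ : A → List B} (h : RightProper τ) :
    LeftProper fun a => (τ a).reverse := by
  obtain ⟨b, hb⟩ := h
  refine ⟨b, fun a => ?_⟩
  obtain ⟨t, ht⟩ := hb a
  exact ⟨t.reverse, by simp [ht]⟩

lemma exists_occ_near_linear_of_rightProper {A : ℕ → Type*}
    [∀ k, Fintype (A k)] [∀ k, DecidableEq (A k)] (σ : ∀ k, A (k + 1) → List (A k))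
    (hproper : ∀ k : ℕ, ∃ m : ℕ, 0 < m ∧ RightProper (seg σ k m))
    (hM : ∀ k : ℕ, ∃ N : Matrix (A (k + 1)) (A k) ℚ,
      N * (Matrix.of fun (b : A k) (a : A (k + 1)) => ((σ k a).count b : ℚ)) = 1)
    (v : List (A 0)) :
    ∃ (c : A 0 → ℚ) (K : ℚ), ∀ w ∈ LangAt σ 0,
      |(occ v w : ℚ) - ∑ b, c b * w.count b| ≤ K := by
  obtain ⟨c, K, h⟩ := exists_occ_near_linear_of_leftProper (fun k a => (σ k a).reverse)
    (fun k => by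
      obtain ⟨m, hm, h⟩ := hproper k
      refine ⟨m, hm, ?_⟩
      rw [funext (seg_reverse σ k m)]
      exact h.reverse)
    (by simpa only [List.count_reverse] using hM) v.reverse
  refine ⟨c, K, fun w hw => ?_⟩
  simpa only [occ_reverse, List.count_reverse] using h _ (reverse_mem_LangAt σ 0 hw)

/-- for a left proper or right proper sequence of substitutions whose
incidence matrices `M_{σ_k} = (|σ_k(a)|_b)_{b ∈ A_k, a ∈ A_{k+1}}` are all
invertible, if `L_σ` is letter-balanced, then `L_σ` is factor-balanced. -/
theorem factor_balanced_of_proper_invertible_sadic {A : ℕ → Type*}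
    [∀ k, Fintype (A k)] [∀ k, DecidableEq (A k)]
    (σ : ∀ k, A (k + 1) → List (A k))
    (hproper : (∀ k : ℕ, ∃ m : ℕ, 0 < m ∧ LeftProper (seg σ k m)) ∨
               (∀ k : ℕ, ∃ m : ℕ, 0 < m ∧ RightProper (seg σ k m)))
    (hM : ∀ k : ℕ, ∃ N : Matrix (A (k + 1)) (A k) ℚ,
      (Matrix.of fun (b : A k) (a : A (k + 1)) => ((σ k a).count b : ℚ)) * N = 1 ∧
      N * (Matrix.of fun (b : A k) (a : A (k + 1)) => ((σ k a).count b : ℚ)) = 1)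
    (hbal : ∃ C : ℕ, ∀ a : A 0, ∀ w ∈ LangAt σ 0, ∀ w' ∈ LangAt σ 0,
      w.length = w'.length →
        |(occ [a] w : ℤ) - (occ [a] w' : ℤ)| ≤ (C : ℤ)) :
    ∀ n : ℕ, 1 ≤ n → ∃ C : ℕ, ∀ v : List (A 0), v.length = n →
      ∀ w ∈ LangAt σ 0, ∀ w' ∈ LangAt σ 0, w.length = w'.length →
        |(occ v w : ℤ) - (occ v w' : ℤ)| ≤ (C : ℤ) := by
  have hlin : ∀ v : List (A 0), ∃ (c : A 0 → ℚ) (K : ℚ), ∀ w ∈ LangAt σ 0,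
      |(occ v w : ℚ) - ∑ b, c b * w.count b| ≤ K := by
    have hM' := fun k => (hM k).imp fun _ h => h.2
    rcases hproper with h | h
    · exact exists_occ_near_linear_of_leftProper σ h hM'
    · exact exists_occ_near_linear_of_rightProper σ h hM'
  obtain ⟨C, hC⟩ := hbal
  have hv : ∀ v : List (A 0), ∃ D : ℕ, ∀ w ∈ LangAt σ 0, ∀ w' ∈ LangAt σ 0,
      w.length = w'.length → |(occ v w : ℤ) - (occ v w' : ℤ)| ≤ (D : ℤ) := by
    intro v
    obtain ⟨c, K, hcK⟩ := hlin v
    obtain ⟨D, hD⟩ := exists_nat_ge (2 * K + ∑ b, |c b| * C)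
    refine ⟨D, fun w hw w' hw' hlen => ?_⟩
    have h1 := hcK w hw
    have h2 := hcK w' hw'
    have h3 : |∑ b, c b * w.count b - ∑ b, c b * w'.count b| ≤ ∑ b, |c b| * C := by
      rw [← Finset.sum_sub_distrib]
      refine (Finset.abs_sum_le_sum_abs _ _).trans (Finset.sum_le_sum fun b _ => ?_)
      rw [← mul_sub, abs_mul]
      refine mul_le_mul_of_nonneg_left ?_ (abs_nonneg _)
      have := hC b w hw w' hw' hlen
      rw [occ_singleton, occ_singleton] at this
      exact_mod_cast this
    have h4 : |(occ v w : ℚ) - occ v w'| ≤ D := by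
      rw [abs_le] at h1 h2 h3 ⊢
      constructor <;> linarith [h1.1, h1.2, h2.1, h2.2, h3.1, h3.2]
    exact_mod_cast h4
  choose D hD using hv
  intro n _
  have hfin : {v : List (A 0) | v.length = n}.Finite := List.finite_length_eq (A 0) n
  refine ⟨hfin.toFinset.sup D, fun v hvn w hw w' hw' hlen => ?_⟩
  refine (hD v w hw w' hw' hlen).trans ?_
  exact_mod_cast Finset.le_sup (f := D) (hfin.mem_toFinset.2 hvn)
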